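/- arXiv:2605.15943 — 8 statements merged into one kernel-verified Lean document; each statement's English description precedes it below -/
import Mathlib

section
/- Let A and A' be symmetric {0,1}-matrices of size n×n that are node-adjacent, and suppose every row sum of A and every row sum of A' is at most D. Then for every matrix V ∈ ℝ^{n×q} with orthonormal columns (VᵀV = I_q), one has |Tr(Vᵀ A² V) − Tr(Vᵀ (A')² V)| ≤ q·D². -/
open Matrix

/-- Schur test for a symmetric entrywise nonnegative matrix with row sums at most `D`. -/
theorem sum_sq_mulVec_le_of_rowSum_le {ι : Type*} [Fintype ι] {D : ℝ} {A : Matrix ι ι ℝ}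
    (hA : ∀ i j, 0 ≤ A i j) (hsymm : A.IsSymm) (hdeg : ∀ i, ∑ j, A i j ≤ D) (v : ι → ℝ) :
    ∑ i, (A *ᵥ v) i ^ 2 ≤ D ^ 2 * ∑ j, v j ^ 2 := by
  have hD (i : ι) : 0 ≤ D := (Finset.sum_nonneg fun j _ => hA i j).trans (hdeg i)
  have hrow (i : ι) : (A *ᵥ v) i ^ 2 ≤ D * ∑ j, A i j * v j ^ 2 := by
    have hcs : (A *ᵥ v) i ^ 2 ≤ (∑ j, A i j) * ∑ j, A i j * v j ^ 2 :=
      Finset.sum_sq_le_sum_mul_sum_of_sq_le_mul _ (fun j _ => hA i j)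
        (fun j _ => mul_nonneg (hA i j) (sq_nonneg _)) (fun j _ => le_of_eq (by ring))
    exact hcs.trans (mul_le_mul_of_nonneg_right (hdeg i)
      (Finset.sum_nonneg fun j _ => mul_nonneg (hA i j) (sq_nonneg _)))
  calc ∑ i, (A *ᵥ v) i ^ 2 ≤ ∑ i, D * ∑ j, A i j * v j ^ 2 :=
        Finset.sum_le_sum fun i _ => hrow i
    _ = ∑ j, D * ((∑ i, A j i) * v j ^ 2) := by
        rw [← Finset.mul_sum, Finset.sum_comm, Finset.mul_sum]
        refine Finset.sum_congr rfl fun j _ => ?_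
        rw [← Finset.sum_mul]
        simp only [hsymm.apply]
    _ ≤ ∑ j, D * (D * v j ^ 2) := Finset.sum_le_sum fun j _ =>
        mul_le_mul_of_nonneg_left (mul_le_mul_of_nonneg_right (hdeg j) (sq_nonneg _)) (hD j)
    _ = D ^ 2 * ∑ j, v j ^ 2 := by
        rw [Finset.mul_sum]
        exact Finset.sum_congr rfl fun j _ => by ring

/-- The trace of `A²` compressed to an orthonormal `q`-frame lies between `0` and `q * D²`. -/
theorem trace_compression_sq_mem_Icc {ι κ : Type*} [Fintype ι] [DecidableEq ι] [Fintype κ]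
    [DecidableEq κ] {D : ℝ} {A : Matrix ι ι ℝ} (hA : ∀ i j, 0 ≤ A i j) (hsymm : A.IsSymm)
    (hdeg : ∀ i, ∑ j, A i j ≤ D) {V : Matrix ι κ ℝ} (hV : Vᵀ * V = 1) :
    (Vᵀ * A ^ 2 * V).trace ∈ Set.Icc 0 (Fintype.card κ * D ^ 2) := by
  have htrace : (Vᵀ * A ^ 2 * V).trace = ∑ k, ∑ i, (A *ᵥ V.col k) i ^ 2 := by
    have hfactor : Vᵀ * A ^ 2 * V = (A * V)ᵀ * (A * V) := by
      rw [Matrix.transpose_mul, hsymm.eq, pow_two]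
      simp only [Matrix.mul_assoc]
    rw [hfactor]
    refine Finset.sum_congr rfl fun k _ => Finset.sum_congr rfl fun i _ => ?_
    exact (pow_two _).symm
  have hunit (k : κ) : ∑ j, V.col k j ^ 2 = 1 := by
    have hk : (Vᵀ * V) k k = 1 := by rw [hV, Matrix.one_apply_eq]
    rw [← hk]
    exact Finset.sum_congr rfl fun j _ => pow_two _
  rw [htrace]
  refine ⟨Finset.sum_nonneg fun k _ => Finset.sum_nonneg fun i _ => sq_nonneg _, ?_⟩
  calc ∑ k, ∑ i, (A *ᵥ V.col k) i ^ 2 ≤ ∑ _k : κ, D ^ 2 := Finset.sum_le_sum fun k _ => by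
        simpa only [hunit, mul_one] using sum_sq_mulVec_le_of_rowSum_le hA hsymm hdeg (V.col k)
    _ = Fintype.card κ * D ^ 2 := by simp



/-- If `A, A'` are node-adjacent symmetric `{0,1}` adjacency matrices whose
row sums (degrees) are all at most `D`, then for every `V` with orthonormal columns,
`|Tr(Vᵀ A² V) − Tr(Vᵀ A'² V)| ≤ q·D²`. -/
theorem score_sensitivity_of_bounded_degree {n q : ℕ} (D : ℝ)
    (A A' : Matrix (Fin n) (Fin n) ℝ)
    (hA01 : ∀ i j, A i j = 0 ∨ A i j = 1)
    (hA'01 : ∀ i j, A' i j = 0 ∨ A' i j = 1)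
    (hAsymm : A.IsSymm) (hA'symm : A'.IsSymm)
    (hadj : ∃ i0 : Fin n, ∀ j l, j ≠ i0 → l ≠ i0 → A j l = A' j l)
    (hdegA : ∀ i, ∑ j, A i j ≤ D)
    (hdegA' : ∀ i, ∑ j, A' i j ≤ D)
    (V : Matrix (Fin n) (Fin q) ℝ) (hV : Vᵀ * V = 1) :
    |(Vᵀ * A ^ 2 * V).trace - (Vᵀ * A' ^ 2 * V).trace| ≤ q * D ^ 2 := by
  have hnonneg {B : Matrix (Fin n) (Fin n) ℝ} (hB : ∀ i j, B i j = 0 ∨ B i j = 1) (i j : Fin n) :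
      0 ≤ B i j := by
    rcases hB i j with h | h <;> simp [h]
  have hT := trace_compression_sq_mem_Icc (hnonneg hA01) hAsymm hdegA hV
  have hT' := trace_compression_sq_mem_Icc (hnonneg hA'01) hA'symm hdegA' hV
  simp only [Fintype.card_fin, Set.mem_Icc] at hT hT'
  rw [abs_le]
  constructor <;> linarith [hT.1, hT.2, hT'.1, hT'.2]
end

section
/- Let A be a symmetric {0,1}-matrix of size n×n, let D > 0, and let V ∈ ℝ^{n×q} have orthonormal columns (VᵀV = I_q). Then ŝ_{A²,D}(V) ≤ Tr(Vᵀ A² V) + Tr(A² J_n). Moreover, if every row sum of A is at most D (maximum degree at most D), then equality holds: ŝ_{A²,D}(V) = Tr(Vᵀ A² V) + Tr(A² J_n) = Tr(A²(VVᵀ + J_n)). -/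
open Matrix

/-- The Lipschitz-extended score `ŝ_{A²,D}(V)`: the supremum of `Tr(C(VVᵀ + Jₙ))` over symmetric
matrices `C` with `0 ≤ C_{jl} ≤ (A²)_{jl}` entrywise and all row sums at most `D²`,
where `Jₙ` is the all-ones matrix. -/
noncomputable def lipScore {n q : ℕ} (D : ℝ) (A : Matrix (Fin n) (Fin n) ℝ)
    (V : Matrix (Fin n) (Fin q) ℝ) : ℝ :=
  sSup {x : ℝ | ∃ C : Matrix (Fin n) (Fin n) ℝ, C.IsSymm ∧
    (∀ j l, 0 ≤ C j l ∧ C j l ≤ (A ^ 2) j l) ∧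
    (∀ j, ∑ l, C j l ≤ D ^ 2) ∧
    x = (C * (V * Vᵀ + Matrix.of fun _ _ => (1 : ℝ))).trace}

/-- The entries of a real symmetric idempotent matrix are at most `1` in absolute value. -/
theorem Matrix.IsSymm.abs_apply_le_one_of_isIdempotentElem {ι : Type*} [Fintype ι]
    {P : Matrix ι ι ℝ} (hP : P.IsSymm) (hP' : IsIdempotentElem P) (j l : ι) : |P j l| ≤ 1 := by
  have hrow : P j j = ∑ k, P j k ^ 2 := by
    conv_lhs => rw [← hP'.eq, Matrix.mul_apply]
    exact Finset.sum_congr rfl fun k _ => by rw [hP.apply j k, sq]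
  have hle (k : ι) : P j k ^ 2 ≤ P j j :=
    hrow ▸ Finset.single_le_sum (f := fun k => P j k ^ 2) (fun _ _ => sq_nonneg _)
      (Finset.mem_univ k)
  rw [← sq_le_one_iff_abs_le_one]
  nlinarith [hle j, hle l]

/-- The entries of `V * Vᵀ + J` are nonnegative when `V` has orthonormal columns. -/
theorem Matrix.mul_transpose_add_ones_nonneg {ι κ : Type*} [Fintype ι] [Fintype κ]
    [DecidableEq κ] {V : Matrix ι κ ℝ} (hV : Vᵀ * V = 1) (j l : ι) :
    0 ≤ (V * Vᵀ + Matrix.of fun _ _ => (1 : ℝ) : Matrix ι ι ℝ) j l := by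
  have hsymm : (V * Vᵀ).IsSymm := by simp [Matrix.IsSymm, Matrix.transpose_mul]
  have hidem : IsIdempotentElem (V * Vᵀ) := by
    rw [IsIdempotentElem, Matrix.mul_assoc, ← Matrix.mul_assoc Vᵀ, hV, Matrix.one_mul]
  have h := neg_le_of_abs_le (hsymm.abs_apply_le_one_of_isIdempotentElem hidem j l)
  simp only [Matrix.add_apply, Matrix.of_apply]
  linarith

/-- The trace pairing with an entrywise nonnegative matrix is monotone. -/
theorem Matrix.trace_mul_le_trace_mul_of_nonneg {ι : Type*} [Fintype ι]
    {B C M : Matrix ι ι ℝ} (hCB : ∀ i j, C i j ≤ B i j) (hM : ∀ i j, 0 ≤ M i j) :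
    (C * M).trace ≤ (B * M).trace := by
  simp only [Matrix.trace, Matrix.diag_apply, Matrix.mul_apply]
  gcongr with i _ j _
  · exact hM j i
  · exact hCB i j

/-- If a nonnegative matrix has row sums at most `D`, its square has row sums at most `D ^ 2`. -/
theorem Matrix.row_sum_sq_le_of_row_sum_le {ι : Type*} [Fintype ι] [DecidableEq ι]
    {A : Matrix ι ι ℝ} {D : ℝ} (hD : 0 ≤ D) (hA : ∀ i j, 0 ≤ A i j)
    (hrow : ∀ i, ∑ j, A i j ≤ D) (j : ι) : ∑ l, (A ^ 2) j l ≤ D ^ 2 := by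
  calc ∑ l, (A ^ 2) j l = ∑ k, A j k * ∑ l, A k l := by
        simp only [pow_two, Matrix.mul_apply, Finset.mul_sum]
        exact Finset.sum_comm
    _ ≤ ∑ k, A j k * D := by
        gcongr with k _
        · exact hA j k
        · exact hrow k
    _ = (∑ k, A j k) * D := (Finset.sum_mul ..).symm
    _ ≤ D ^ 2 := by rw [sq]; gcongr; exact hrow j

/-- For any symmetric `{0,1}` matrix `A`, `D > 0`, and `V` with orthonormal
columns, `ŝ_{A²,D}(V) ≤ Tr(Vᵀ A² V) + Tr(A² Jₙ)`; and if every row sum of `A` is at most `D`,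
then equality holds, with common value `Tr(A²(VVᵀ + Jₙ))`. -/
theorem lipScore_le_and_eq_of_bounded_degree {n q : ℕ} (D : ℝ) (hD : 0 < D)
    (A : Matrix (Fin n) (Fin n) ℝ)
    (hA01 : ∀ i j, A i j = 0 ∨ A i j = 1) (hAsymm : A.IsSymm)
    (V : Matrix (Fin n) (Fin q) ℝ) (hV : Vᵀ * V = 1) :
    lipScore D A V ≤ (Vᵀ * A ^ 2 * V).trace + (A ^ 2 * Matrix.of fun _ _ => (1 : ℝ)).trace ∧
    ((∀ i, ∑ j, A i j ≤ D) →
      lipScore D A V = (Vᵀ * A ^ 2 * V).trace + (A ^ 2 * Matrix.of fun _ _ => (1 : ℝ)).trace ∧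
      lipScore D A V = (A ^ 2 * (V * Vᵀ + Matrix.of fun _ _ => (1 : ℝ))).trace) := by
  have hA (i j : Fin n) : 0 ≤ A i j := by rcases hA01 i j with h | h <;> simp [h]
  have hA2 (i j : Fin n) : 0 ≤ (A ^ 2) i j := by
    rw [sq, Matrix.mul_apply]
    exact Finset.sum_nonneg fun k _ => mul_nonneg (hA i k) (hA k j)
  have htrace : (A ^ 2 * (V * Vᵀ + Matrix.of fun _ _ => (1 : ℝ))).trace =
      (Vᵀ * A ^ 2 * V).trace + (A ^ 2 * Matrix.of fun _ _ => (1 : ℝ)).trace := by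
    rw [Matrix.mul_add, Matrix.trace_add, ← Matrix.mul_assoc, Matrix.trace_mul_comm,
      ← Matrix.mul_assoc]
  rw [← htrace, and_self]
  unfold lipScore
  set S := {x : ℝ | ∃ C : Matrix (Fin n) (Fin n) ℝ, C.IsSymm ∧
    (∀ j l, 0 ≤ C j l ∧ C j l ≤ (A ^ 2) j l) ∧
    (∀ j, ∑ l, C j l ≤ D ^ 2) ∧
    x = (C * (V * Vᵀ + Matrix.of fun _ _ => (1 : ℝ))).trace}
  have hub : (A ^ 2 * (V * Vᵀ + Matrix.of fun _ _ => (1 : ℝ))).trace ∈ upperBounds S := by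
    rintro x ⟨C, -, hC, -, rfl⟩
    exact Matrix.trace_mul_le_trace_mul_of_nonneg (fun i j => (hC i j).2)
      (Matrix.mul_transpose_add_ones_nonneg hV)
  refine ⟨csSup_le ⟨0, 0, Matrix.isSymm_zero, fun j l => ⟨le_rfl, hA2 j l⟩, ?_, by simp⟩ hub,
    fun hdeg => IsGreatest.csSup_eq ⟨⟨A ^ 2, hAsymm.pow 2, fun j l => ⟨hA2 j l, le_rfl⟩,
      Matrix.row_sum_sq_le_of_row_sum_le hD.le hA hdeg, rfl⟩, hub⟩⟩
  intro j
  simpa using sq_nonneg D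
end

section
/- Let A, B ∈ ℝ^{n×n}, where A is symmetric and either positive semidefinite (A ⪰ 0) or negative semidefinite (A ⪯ 0). Then ‖A ⊙ B‖₂ ≤ (max_{i,j} |A_{ij}|) · ‖B‖₂, where A ⊙ B denotes the entrywise (Hadamard) product and ‖·‖₂ denotes the spectral norm (the ℓ²→ℓ² operator norm, i.e. the largest singular value). -/
open Matrix

/-- The spectral norm (ℓ²→ℓ² operator norm, i.e. largest singular value) of a square real
matrix. -/
noncomputable def specNorm {n : ℕ} (M : Matrix (Fin n) (Fin n) ℝ) : ℝ :=
  ‖Matrix.toEuclideanCLM (𝕜 := ℝ) M‖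

theorem specNorm_neg {n : ℕ} (M : Matrix (Fin n) (Fin n) ℝ) : specNorm (-M) = specNorm M := by
  simp [specNorm]

/-- The bilinear form of the Hadamard product of `∑ k, vₖ vₖᵀ` with `B` is a sum of values of the
bilinear form of `B`. -/
theorem dotProduct_hadamard_sum_vecMulVec_mulVec {m n : ℕ} (v : Fin m → Fin n → ℝ)
    (B : Matrix (Fin n) (Fin n) ℝ) (x y : Fin n → ℝ) :
    x ⬝ᵥ (hadamard (∑ k, vecMulVec (v k) (v k)) B) *ᵥ y =
      ∑ k, (v k * x) ⬝ᵥ B *ᵥ (v k * y) := by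
  simp only [dotProduct, mulVec, hadamard_apply, Matrix.sum_apply, vecMulVec_apply,
    Pi.mul_apply, Finset.sum_mul, Finset.mul_sum]
  rw [Finset.sum_comm_cycle]
  refine Finset.sum_congr rfl fun k _ => ?_
  refine Finset.sum_congr rfl fun i _ => Finset.sum_congr rfl fun j _ => ?_
  ring

theorem sum_norm_sq_mul_le {m n : ℕ} (v : Fin m → Fin n → ℝ) {a : ℝ}
    (ha : ∀ i, ∑ k, v k i ^ 2 ≤ a) (x : EuclideanSpace ℝ (Fin n)) :
    ∑ k, ‖WithLp.toLp 2 (v k * x.ofLp)‖ ^ 2 ≤ a * ‖x‖ ^ 2 := by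
  simp only [EuclideanSpace.norm_sq_eq, Pi.mul_apply, Real.norm_eq_abs, sq_abs, mul_pow]
  rw [Finset.sum_comm, Finset.mul_sum]
  refine Finset.sum_le_sum fun i _ => ?_
  rw [← Finset.sum_mul]
  exact mul_le_mul_of_nonneg_right (ha i) (sq_nonneg _)

/-- Schur's bound: the Hadamard multiplier by a positive semidefinite matrix is bounded in spectral
norm by any bound on its diagonal entries. -/
theorem Matrix.PosSemidef.specNorm_hadamard_le_of_diag_le {n : ℕ}
    {A : Matrix (Fin n) (Fin n) ℝ} (hA : A.PosSemidef) (B : Matrix (Fin n) (Fin n) ℝ) {a : ℝ}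
    (ha₀ : 0 ≤ a) (ha : ∀ i, A i i ≤ a) :
    specNorm (Matrix.hadamard A B) ≤ a * specNorm B := by
  obtain ⟨m, v, rfl⟩ := posSemidef_iff_eq_sum_vecMulVec.mp hA
  simp only [star_trivial] at ha ⊢
  have hv : ∀ i, ∑ k, v k i ^ 2 ≤ a := fun i => by
    simpa [Matrix.sum_apply, vecMulVec_apply, sq] using ha i
  have hB : 0 ≤ specNorm B := norm_nonneg _
  refine ContinuousLinearMap.opNorm_le_of_re_inner_le (𝕜 := ℝ) (mul_nonneg ha₀ hB)
    fun x y hx hy => ?_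
  rw [RCLike.re_to_real, real_inner_comm, inner_toEuclideanCLM,
    dotProduct_hadamard_sum_vecMulVec_mulVec]
  have hx' := sum_norm_sq_mul_le v hv x
  have hy' := sum_norm_sq_mul_le v hv y
  rw [hx, one_pow, mul_one] at hx'
  rw [hy, one_pow, mul_one] at hy'
  calc ∑ k, (v k * y.ofLp) ⬝ᵥ B *ᵥ (v k * x.ofLp)
      ≤ ∑ k, specNorm B * ((‖WithLp.toLp 2 (v k * y.ofLp)‖ ^ 2 +
          ‖WithLp.toLp 2 (v k * x.ofLp)‖ ^ 2) / 2) := by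
        refine Finset.sum_le_sum fun k _ => ?_
        set p := WithLp.toLp 2 (v k * y.ofLp)
        set q := WithLp.toLp 2 (v k * x.ofLp)
        calc (v k * y.ofLp) ⬝ᵥ B *ᵥ (v k * x.ofLp)
            = inner ℝ p (toEuclideanCLM (𝕜 := ℝ) B q) := (inner_toEuclideanCLM B p q).symm
          _ ≤ ‖p‖ * ‖toEuclideanCLM (𝕜 := ℝ) B q‖ := real_inner_le_norm _ _
          _ ≤ ‖p‖ * (specNorm B * ‖q‖) := by
              gcongr
              exact ContinuousLinearMap.le_opNorm _ _
          _ = specNorm B * (‖p‖ * ‖q‖) := by ring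
          _ ≤ specNorm B * ((‖p‖ ^ 2 + ‖q‖ ^ 2) / 2) := by
              gcongr
              linarith [two_mul_le_add_sq ‖p‖ ‖q‖]
    _ ≤ specNorm B * a := by
        rw [← Finset.mul_sum, ← Finset.sum_div, Finset.sum_add_distrib]
        gcongr
        linarith
    _ = a * specNorm B := mul_comm _ _

/-- If `A` is symmetric and positive or negative semidefinite, then the
spectral norm of the Hadamard product satisfies
`‖A ⊙ B‖₂ ≤ (max_{i,j} |A_{ij}|) · ‖B‖₂`. -/
theorem specNorm_hadamard_le {n : ℕ} (A B : Matrix (Fin n) (Fin n) ℝ)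
    (hAsymm : A.IsSymm) (hA : A.PosSemidef ∨ (-A).PosSemidef) :
    specNorm (Matrix.hadamard A B) ≤ (⨆ i, ⨆ j, |A i j|) * specNorm B := by
  have ha₀ : 0 ≤ ⨆ i, ⨆ j, |A i j| :=
    Real.iSup_nonneg fun _ => Real.iSup_nonneg fun _ => abs_nonneg _
  have ha : ∀ i, |A i i| ≤ ⨆ i, ⨆ j, |A i j| := fun i =>
    (le_ciSup (f := fun j => |A i j|) (Set.finite_range _).bddAbove i).trans
      (le_ciSup (f := fun i => ⨆ j, |A i j|) (Set.finite_range _).bddAbove i)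
  rcases hA with hA | hA
  · exact hA.specNorm_hadamard_le_of_diag_le B ha₀ fun i => (le_abs_self _).trans (ha i)
  · have hneg : hadamard (-A) B = -hadamard A B := by
      ext i j
      simp
    rw [← specNorm_neg, ← hneg]
    exact hA.specNorm_hadamard_le_of_diag_le B ha₀ fun i => (neg_le_abs _).trans (ha i)
end

section
/- Let Θ, Θ̂ ∈ M_{n×k}. If every community of Θ (the set {i : Θ_{ij} = 1} for each j) has size at least 6, and the worst-case misclassification error satisfies 𝓛̃(Θ̂, Θ) ≤ 1/3, then Θ̂ is a stable approximation of Θ. -/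
/-- The worst-case misclassification error `𝓛̃(θ̂, θ)`:
`min_{σ ∈ S_k} max_{j ∈ [k]} (2/|C_j|) Σ_{i ∈ C_j} 1{σ(θ̂_i) ≠ j}`, where
`C_j = {i : θ_i = j}`. -/
noncomputable def wcErr {n k : ℕ} (θhat θ : Fin n → Fin k) : ℝ :=
  ⨅ σ : Equiv.Perm (Fin k), ⨆ j : Fin k,
    (2 / ((Finset.univ.filter fun i => θ i = j).card : ℝ)) *
      ((Finset.univ.filter fun i => θ i = j ∧ σ (θhat i) ≠ j).card : ℝ)

/-- The number of misclassified nodes under the relabeling `σ`; `‖Θ̂ J_σ − Θ‖₀` equals twice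
this quantity. -/
def misCount {n k : ℕ} (θhat θ : Fin n → Fin k) (σ : Equiv.Perm (Fin k)) : ℕ :=
  (Finset.univ.filter fun i => σ (θhat i) ≠ θ i).card

/-- The set `argmin_{J ∈ E_k} ‖Θ̂ J − Θ‖₀`, identified with the set of relabeling
permutations minimizing the number of misclassified nodes. -/
def argminSet {n k : ℕ} (θhat θ : Fin n → Fin k) : Set (Equiv.Perm (Fin k)) :=
  {σ | ∀ σ', misCount θhat θ σ ≤ misCount θhat θ σ'}

/-- `Θ̂` is a stable approximation of `Θ` if the argmin set is unchanged when any two rows of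
`Θ̂` are switched. -/
def IsStable {n k : ℕ} (θhat θ : Fin n → Fin k) : Prop :=
  ∀ a b : Fin n, argminSet (θhat ∘ Equiv.swap a b) θ = argminSet θhat θ

/-- The number of nodes of community `j` that are misclassified under the relabeling `σ`. -/
def commErr {n k : ℕ} (θhat θ : Fin n → Fin k) (σ : Equiv.Perm (Fin k)) (j : Fin k) : ℕ :=
  (Finset.univ.filter fun i => θ i = j ∧ σ (θhat i) ≠ j).card

theorem misCount_eq_sum_commErr {n k : ℕ} (θhat θ : Fin n → Fin k) (σ : Equiv.Perm (Fin k)) :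
    misCount θhat θ σ = ∑ j, commErr θhat θ σ j := by
  unfold misCount commErr
  rw [Finset.card_eq_sum_card_fiberwise (f := θ) (t := Finset.univ) (fun _ _ => by simp)]
  refine Finset.sum_congr rfl fun j _ => ?_
  congr 1
  ext i
  simp only [Finset.mem_filter, Finset.mem_univ, true_and]
  constructor
  · rintro ⟨h, rfl⟩
    exact ⟨rfl, h⟩
  · rintro ⟨rfl, h⟩
    exact ⟨h, rfl⟩

/-- Two relabelings that send different labels to `j` cannot both be correct at a node of
community `j`. -/
theorem card_le_commErr_add_commErr {n k : ℕ} (θhat θ : Fin n → Fin k)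
    {σ τ : Equiv.Perm (Fin k)} {j : Fin k} (h : σ.symm j ≠ τ.symm j) :
    (Finset.univ.filter fun i => θ i = j).card ≤ commErr θhat θ σ j + commErr θhat θ τ j := by
  unfold commErr
  refine (Finset.card_le_card fun i hi => ?_).trans (Finset.card_union_le _ _)
  simp only [Finset.mem_union, Finset.mem_filter, Finset.mem_univ, true_and] at hi ⊢
  by_cases h₁ : σ (θhat i) = j
  · refine Or.inr ⟨hi, fun h₂ => h ?_⟩
    rw [(Equiv.symm_apply_eq σ).2 h₁.symm, (Equiv.symm_apply_eq τ).2 h₂.symm]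
  · exact Or.inl ⟨hi, h₁⟩

theorem commErr_congr {n k : ℕ} (θhat θ : Fin n → Fin k)
    {σ τ : Equiv.Perm (Fin k)} {j : Fin k} (h : σ.symm j = τ.symm j) :
    commErr θhat θ σ j = commErr θhat θ τ j := by
  have key : ∀ x, σ x = j ↔ τ x = j := fun x => by
    rw [← Equiv.eq_symm_apply, ← Equiv.eq_symm_apply, h]
  simp only [commErr, ne_eq, key]

/-- A relabeling that is correct on a strict majority of every community is the unique
minimizer of the number of misclassified nodes. -/
theorem argminSet_eq_singleton {n k : ℕ} (θhat θ : Fin n → Fin k) (σ : Equiv.Perm (Fin k))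
    (hσ : ∀ j, 2 * commErr θhat θ σ j < (Finset.univ.filter fun i => θ i = j).card) :
    argminSet θhat θ = {σ} := by
  have hlt : ∀ τ j, σ.symm j ≠ τ.symm j → commErr θhat θ σ j < commErr θhat θ τ j := by
    intro τ j h
    have h₁ := card_le_commErr_add_commErr θhat θ h
    have h₂ := hσ j
    omega
  have hle : ∀ τ j, commErr θhat θ σ j ≤ commErr θhat θ τ j := fun τ j => by
    by_cases h : σ.symm j = τ.symm j
    · exact (commErr_congr θhat θ h).le
    · exact (hlt τ j h).le
  ext τ
  simp only [argminSet, Set.mem_ofPred_eq, Set.mem_singleton_iff, misCount_eq_sum_commErr]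
  constructor
  · intro hτ
    by_contra hne
    obtain ⟨j, hj⟩ : ∃ j, σ.symm j ≠ τ.symm j := by
      by_contra! hall
      exact hne (Equiv.symm_bijective.injective (Equiv.ext hall)).symm
    exact (hτ σ).not_gt
      (Finset.sum_lt_sum (fun j _ => hle τ j) ⟨j, Finset.mem_univ j, hlt τ j hj⟩)
  · rintro rfl τ
    exact Finset.sum_le_sum fun j _ => hle τ j

/-- Switching two rows creates at most one new error in each community. -/
theorem commErr_comp_swap_le {n k : ℕ} (θhat θ : Fin n → Fin k) (σ : Equiv.Perm (Fin k))
    (a b : Fin n) (j : Fin k) :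
    commErr (θhat ∘ Equiv.swap a b) θ σ j ≤ commErr θhat θ σ j + 1 := by
  unfold commErr
  have hinsert : ∀ c : Fin n, (∀ i, θ i = j → i ≠ c → Equiv.swap a b i = i) →
      (Finset.univ.filter fun i => θ i = j ∧ σ ((θhat ∘ Equiv.swap a b) i) ≠ j).card ≤
        (Finset.univ.filter fun i => θ i = j ∧ σ (θhat i) ≠ j).card + 1 := by
    intro c hc
    refine (Finset.card_le_card fun i hi => ?_).trans (Finset.card_insert_le c _)
    simp only [Finset.mem_insert, Finset.mem_filter, Finset.mem_univ, true_and,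
      Function.comp_apply] at hi ⊢
    by_cases hic : i = c
    · exact Or.inl hic
    · rw [hc i hi.1 hic] at hi
      exact Or.inr hi
  by_cases ha : θ a = j
  · by_cases hb : θ b = j
    · refine (Finset.card_le_card_of_injOn (Equiv.swap a b) (fun i hi => ?_)
        (Equiv.swap a b).injective.injOn).trans (Nat.le_succ _)
      simp only [Finset.coe_filter, Finset.mem_univ, true_and, Set.mem_ofPred_eq,
        Function.comp_apply] at hi ⊢
      refine ⟨?_, hi.2⟩
      rw [Equiv.swap_apply_def]
      split_ifs
      exacts [hb, ha, hi.1]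
    · exact hinsert a fun i hi hia =>
        Equiv.swap_apply_of_ne_of_ne hia (by rintro rfl; exact hb hi)
  · exact hinsert b fun i hi hib =>
      Equiv.swap_apply_of_ne_of_ne (by rintro rfl; exact ha hi) hib

theorem exists_perm_six_mul_commErr_le {n k : ℕ} (θhat θ : Fin n → Fin k)
    (hcomm : ∀ j : Fin k, 6 ≤ (Finset.univ.filter fun i => θ i = j).card)
    (herr : wcErr θhat θ ≤ 1 / 3) :
    ∃ σ : Equiv.Perm (Fin k), ∀ j,
      6 * commErr θhat θ σ j ≤ (Finset.univ.filter fun i => θ i = j).card := by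
  obtain ⟨σ, hσ⟩ := exists_eq_ciInf_of_finite (f := fun σ : Equiv.Perm (Fin k) =>
    ⨆ j : Fin k, (2 / ((Finset.univ.filter fun i => θ i = j).card : ℝ)) *
      ((Finset.univ.filter fun i => θ i = j ∧ σ (θhat i) ≠ j).card : ℝ))
  refine ⟨σ, fun j => ?_⟩
  have h : (2 / ((Finset.univ.filter fun i => θ i = j).card : ℝ)) *
      (commErr θhat θ σ j : ℝ) ≤ 1 / 3 :=
    ((le_ciSup (Set.finite_range _).bddAbove j).trans hσ.le).trans herr
  have hpos : (0 : ℝ) < ((Finset.univ.filter fun i => θ i = j).card : ℝ) := by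
    exact_mod_cast (by norm_num : 0 < 6).trans_le (hcomm j)
  rw [div_mul_eq_mul_div, div_le_iff₀ hpos] at h
  have h' : (6 * commErr θhat θ σ j : ℝ) ≤
      ((Finset.univ.filter fun i => θ i = j).card : ℝ) := by linarith
  exact_mod_cast h'

/-- If every community of `θ` has size at least `6` and
`𝓛̃(θ̂, θ) ≤ 1/3`, then `θ̂` is a stable approximation of `θ`. -/
theorem stable_of_small_worst_case_error {n k : ℕ} (θhat θ : Fin n → Fin k)
    (hcomm : ∀ j : Fin k, 6 ≤ (Finset.univ.filter fun i => θ i = j).card)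
    (herr : wcErr θhat θ ≤ 1 / 3) :
    IsStable θhat θ := by
  obtain ⟨σ, hσ⟩ := exists_perm_six_mul_commErr_le θhat θ hcomm herr
  intro a b
  rw [argminSet_eq_singleton θhat θ σ, argminSet_eq_singleton (θhat ∘ Equiv.swap a b) θ σ]
  · intro j
    have h₁ := commErr_comp_swap_le θhat θ σ a b j
    have h₂ := hσ j
    have h₃ := hcomm j
    omega
  · intro j
    have h₂ := hσ j
    have h₃ := hcomm j
    omega
end

section
/- Let M : {0,1}^{n×n} → M_{n×k} be a symmetric (ε,δ)-node differentially private randomized mechanism (ε, δ ≥ 0). Then for every matrix A ∈ {0,1}^{n×n}, every Θ̂ ∈ M_{n×k}, and every n×n permutation matrix J corresponding to a transposition (swapping two indices), P(M(A) = Θ̂) ≤ e^{2ε} · P(M(A) = J Θ̂) + 2δ e^{ε}. -/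
open Matrix

/-- The permutation matrix of `σ`: the matrix `L` with `L_{ij} = 1` iff `σ j = i`. -/
def permMat {n : ℕ} (σ : Equiv.Perm (Fin n)) : Matrix (Fin n) (Fin n) ℝ :=
  Matrix.of fun i j => if σ j = i then 1 else 0

/-- `A` is a `{0,1}`-matrix. -/
def Is01 {n : ℕ} (A : Matrix (Fin n) (Fin n) ℝ) : Prop :=
  ∀ i j, A i j = 0 ∨ A i j = 1

/-- `A` and `A'` are node-adjacent: they differ only in the row and column of a single
index `i0`. -/
def NodeAdj {n : ℕ} (A A' : Matrix (Fin n) (Fin n) ℝ) : Prop :=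
  ∃ i0 : Fin n, ∀ j l, j ≠ i0 → l ≠ i0 → A j l = A' j l

/-- The mechanism `M` on `{0,1}` matrices is `(ε,δ)`-node differentially private. -/
def IsNodeDP {n k : ℕ} (M : Matrix (Fin n) (Fin n) ℝ → PMF (Fin n → Fin k))
    (ε δ : ℝ) : Prop :=
  ∀ A A', Is01 A → Is01 A' → NodeAdj A A' → ∀ S : Set (Fin n → Fin k),
    (M A).toOuterMeasure S
      ≤ ENNReal.ofReal (Real.exp ε) * (M A').toOuterMeasure S + ENNReal.ofReal δ

/-- The mechanism `M` is symmetric: for every permutation matrix `L`, `{0,1}`-input `A` and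
label vector `θ̂`, `P(M(A) = θ̂) = P(M(L A Lᵀ) = L θ̂)`, where `L θ̂ = fun i => θ̂ (σ⁻¹ i)` is
the action of `L` on label vectors. -/
def IsSymmetricMech {n k : ℕ}
    (M : Matrix (Fin n) (Fin n) ℝ → PMF (Fin n → Fin k)) : Prop :=
  ∀ (σ : Equiv.Perm (Fin n)) (A : Matrix (Fin n) (Fin n) ℝ) (θhat : Fin n → Fin k),
    Is01 A →
    M A θhat = M (permMat σ * A * (permMat σ)ᵀ) (fun i => θhat (σ⁻¹ i))

theorem permMat_mul_mul_transpose_apply {n : ℕ} (σ : Equiv.Perm (Fin n))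
    (A : Matrix (Fin n) (Fin n) ℝ) (i j : Fin n) :
    (permMat σ * A * (permMat σ)ᵀ) i j = A (σ⁻¹ i) (σ⁻¹ j) := by
  simp [permMat, Matrix.mul_apply, ← Equiv.Perm.eq_inv_iff_eq]

theorem IsNodeDP.apply_le {n k : ℕ} {M : Matrix (Fin n) (Fin n) ℝ → PMF (Fin n → Fin k)}
    {ε δ : ℝ} (hDP : IsNodeDP M ε δ) {A A' : Matrix (Fin n) (Fin n) ℝ} (hA : Is01 A)
    (hA' : Is01 A') (h : NodeAdj A A') (θ : Fin n → Fin k) :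
    M A θ ≤ ENNReal.ofReal (Real.exp ε) * M A' θ + ENNReal.ofReal δ := by
  simpa only [PMF.toOuterMeasure_apply_singleton] using hDP A A' hA hA' h {θ}

/-- The matrices `A` and `J A Jᵀ`, for `J` the transposition of `a` and `b`, are joined by two
node-adjacency steps through `{0,1}`-matrices. -/
theorem exists_nodeAdj_nodeAdj_swap {n : ℕ} {A : Matrix (Fin n) (Fin n) ℝ} (hA : Is01 A)
    (a b : Fin n) :
    ∃ C, Is01 C ∧ NodeAdj A C ∧
      NodeAdj C (permMat (Equiv.swap a b) * A * (permMat (Equiv.swap a b))ᵀ) := by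
  refine ⟨Matrix.of fun i j => if i = a ∨ j = a then A (Equiv.swap a b i) (Equiv.swap a b j)
    else A i j, fun i j => ?_, ⟨a, fun i j hi hj => by simp [hi, hj]⟩, ⟨b, fun i j hi hj => ?_⟩⟩
  · simp only [Matrix.of_apply]
    split_ifs
    exacts [hA _ _, hA _ _]
  · rw [permMat_mul_mul_transpose_apply, Equiv.swap_inv, Matrix.of_apply]
    split_ifs with h
    · rfl
    · push Not at h
      rw [Equiv.swap_apply_of_ne_of_ne h.1 hi, Equiv.swap_apply_of_ne_of_ne h.2 hj]

/-- For a symmetric `(ε,δ)`-node DP mechanism `M`, every `{0,1}` matrix `A`,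
every one-hot output `θ̂` and every transposition `J` (swapping two distinct indices `a ≠ b`),
`P(M(A) = θ̂) ≤ e^{2ε} P(M(A) = J θ̂) + 2δe^ε`. -/
theorem prob_le_of_transposition {n k : ℕ} (ε δ : ℝ) (hε : 0 ≤ ε) (hδ : 0 ≤ δ)
    (M : Matrix (Fin n) (Fin n) ℝ → PMF (Fin n → Fin k))
    (hDP : IsNodeDP M ε δ) (hsym : IsSymmetricMech M) :
    ∀ A : Matrix (Fin n) (Fin n) ℝ, Is01 A →
      ∀ (θhat : Fin n → Fin k) (a b : Fin n), a ≠ b →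
        M A θhat
          ≤ ENNReal.ofReal (Real.exp (2 * ε)) * M A (fun i => θhat ((Equiv.swap a b)⁻¹ i))
            + ENNReal.ofReal (2 * δ * Real.exp ε) := by
  intro A hA θhat a b _
  obtain ⟨C, hC, hAC, hCB⟩ := exists_nodeAdj_nodeAdj_swap hA a b
  set B := permMat (Equiv.swap a b) * A * (permMat (Equiv.swap a b))ᵀ with hBdef
  have hB : Is01 B := fun i j => by
    rw [hBdef, permMat_mul_mul_transpose_apply]
    exact hA _ _
  have hMB : M A (fun i => θhat ((Equiv.swap a b)⁻¹ i)) = M B θhat := by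
    rw [hsym (Equiv.swap a b) A _ hA]
    simp [hBdef]
  have hexp : (1 : ℝ) ≤ Real.exp ε := Real.one_le_exp hε
  have hpos := (Real.exp_pos ε).le
  rw [hMB]
  calc M A θhat
      ≤ ENNReal.ofReal (Real.exp ε) * M C θhat + ENNReal.ofReal δ :=
        hDP.apply_le hA hC hAC θhat
    _ ≤ ENNReal.ofReal (Real.exp ε) *
          (ENNReal.ofReal (Real.exp ε) * M B θhat + ENNReal.ofReal δ) + ENNReal.ofReal δ := by
        gcongr
        exact hDP.apply_le hC hB hCB θhat
    _ = ENNReal.ofReal (Real.exp (2 * ε)) * M B θhat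
          + ENNReal.ofReal (Real.exp ε * δ + δ) := by
        rw [two_mul, Real.exp_add, ENNReal.ofReal_mul hpos,
          ENNReal.ofReal_add (mul_nonneg hpos hδ) hδ, ENNReal.ofReal_mul hpos]
        ring
    _ ≤ _ := by
        gcongr
        nlinarith
end

section
/- Let k ≥ 1 divide n with n/k ≥ 6, let θ ∈ [k]^n be balanced (every community C_j = {i : θ_i = j} has size n/k), and let M : {0,1}^{n×n} → M_{n×k} be a symmetric (ε,δ)-node differentially private randomized mechanism (ε, δ ≥ 0). Then for every matrix A ∈ {0,1}^{n×n} and every ξ ∈ (0,1/3), P(𝓛̃(M(A), θ) ≤ ξ) ≤ 1/((1−ξ)(1+(k−1)e^{−2ε})) + 2(k−1)δ/(1−ξ). -/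
open Matrix

/-- The labelling `x`, relabelled by `σ`, makes at most `c` errors in each community of `θ`. -/
def FewErrors {n k : ℕ} (θ : Fin n → Fin k) (c : ℝ) (x : Fin n → Fin k)
    (σ : Equiv.Perm (Fin k)) : Prop :=
  ∀ j, ((Finset.univ.filter fun i => θ i = j ∧ σ (x i) ≠ j).card : ℝ) ≤ c

theorem FewErrors.comp_swap {n k : ℕ} {θ : Fin n → Fin k} {c : ℝ} {x : Fin n → Fin k}
    {σ : Equiv.Perm (Fin k)} {i j : Fin n} (h : FewErrors θ c (x ∘ Equiv.swap i j) σ) :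
    FewErrors θ (c + 2) x σ := by
  intro a
  have hsub : (Finset.univ.filter fun l => θ l = a ∧ σ (x l) ≠ a) ⊆
      (Finset.univ.filter fun l => θ l = a ∧ σ ((x ∘ Equiv.swap i j) l) ≠ a) ∪ {i, j} := by
    intro l hl
    simp only [Finset.mem_filter, Finset.mem_univ, true_and, Finset.mem_union,
      Finset.mem_insert, Finset.mem_singleton, Function.comp_apply] at hl ⊢
    by_cases h1 : l = i
    · exact Or.inr (Or.inl h1)
    by_cases h2 : l = j
    · exact Or.inr (Or.inr h2)
    rw [Equiv.swap_apply_of_ne_of_ne h1 h2]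
    exact Or.inl hl
  have hcard := (Finset.card_le_card hsub).trans (Finset.card_union_le _ _)
  have hpair : ({i, j} : Finset (Fin n)).card ≤ 2 := Finset.card_le_two
  have hle := hcard.trans (Nat.add_le_add_left hpair _)
  have hle' := (Nat.cast_le (α := ℝ)).2 hle
  push_cast at hle'
  exact hle'.trans (by linarith [h a])

theorem FewErrors.mono {n k : ℕ} {θ : Fin n → Fin k} {c d : ℝ} (hcd : c ≤ d)
    {x : Fin n → Fin k} {σ : Equiv.Perm (Fin k)} (h : FewErrors θ c x σ) :
    FewErrors θ d x σ := fun j => (h j).trans hcd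

theorem FewErrors.unique {n k m : ℕ} {θ : Fin n → Fin k} {c : ℝ}
    (hbal : ∀ j : Fin k, (Finset.univ.filter fun i => θ i = j).card = m)
    (hc : 2 * c < m) {x : Fin n → Fin k} {σ τ : Equiv.Perm (Fin k)}
    (hσ : FewErrors θ c x σ) (hτ : FewErrors θ c x τ) : σ = τ := by
  have key : ∀ j, ∃ i, σ (x i) = j ∧ τ (x i) = j := by
    intro j
    by_contra! hne
    have hsub : (Finset.univ.filter fun i => θ i = j) ⊆
        (Finset.univ.filter fun i => θ i = j ∧ σ (x i) ≠ j) ∪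
          (Finset.univ.filter fun i => θ i = j ∧ τ (x i) ≠ j) := by
      intro i hi
      have := hne i
      simp only [Finset.mem_filter, Finset.mem_univ, true_and, Finset.mem_union] at hi ⊢
      tauto
    have hle := (Finset.card_le_card hsub).trans (Finset.card_union_le _ _)
    rw [hbal] at hle
    have hle' := (Nat.cast_le (α := ℝ)).2 hle
    push_cast at hle'
    linarith [hσ j, hτ j]
  have hsymm : σ.symm = τ.symm := by
    ext j
    obtain ⟨i, h1, h2⟩ := key j
    rw [(Equiv.symm_apply_eq σ).2 h1.symm, (Equiv.symm_apply_eq τ).2 h2.symm]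
  simpa using congrArg Equiv.symm hsymm

theorem exists_fewErrors_of_wcErr_le {n k m : ℕ} (hm : 0 < m)
    {θ : Fin n → Fin k}
    (hbal : ∀ j : Fin k, (Finset.univ.filter fun i => θ i = j).card = m)
    {x : Fin n → Fin k} {ξ : ℝ} (h : wcErr x θ ≤ ξ) :
    ∃ σ, FewErrors θ (ξ * m / 2) x σ := by
  obtain ⟨σ, hσ⟩ := exists_eq_ciInf_of_finite (f := fun σ : Equiv.Perm (Fin k) => ⨆ j : Fin k,
    (2 / ((Finset.univ.filter fun i => θ i = j).card : ℝ)) *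
      ((Finset.univ.filter fun i => θ i = j ∧ σ (x i) ≠ j).card : ℝ))
  refine ⟨σ, fun j => ?_⟩
  have hj := (le_ciSup (Set.finite_range _).bddAbove j).trans (hσ.le.trans h)
  have hm' : (0 : ℝ) < m := by exact_mod_cast hm
  rw [hbal j, div_mul_eq_mul_div, div_le_iff₀ hm'] at hj
  linarith

open Classical in
/-- The sum of the weights `μ x` over the points `x` satisfying `P`. -/
noncomputable def weight {α : Type*} [Fintype α] (μ : α → ℝ) (P : α → Prop) : ℝ :=
  ∑ x, if P x then μ x else 0

theorem weight_mono {α : Type*} [Fintype α] {μ : α → ℝ} (hμ : ∀ x, 0 ≤ μ x)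
    {P Q : α → Prop} (h : ∀ x, P x → Q x) : weight μ P ≤ weight μ Q := by
  refine Finset.sum_le_sum fun x _ => ?_
  by_cases hP : P x
  · simp [hP, h x hP]
  · by_cases hQ : Q x <;> simp [hP, hQ, hμ x]

theorem sum_weight_le {α ι : Type*} [Fintype α] [Fintype ι] {μ : α → ℝ} (hμ : ∀ x, 0 ≤ μ x)
    {P : ι → α → Prop} (h : ∀ x b b', P b x → P b' x → b = b') :
    ∑ b, weight μ (P b) ≤ ∑ x, μ x := by
  classical
  unfold weight
  rw [Finset.sum_comm]
  refine Finset.sum_le_sum fun x _ => ?_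
  by_cases hx : ∃ b, P b x
  · obtain ⟨b, hb⟩ := hx
    rw [Finset.sum_eq_single b]
    · simp [hb]
    · intro b' _ hne
      exact if_neg fun hb' => hne (h x b' b hb' hb)
    · simp
  · push Not at hx
    simp [hx, hμ x]

theorem le_sum_weight {α ι : Type*} [Fintype α] [Fintype ι] {μ : α → ℝ} (hμ : ∀ x, 0 ≤ μ x)
    {G : α → Prop} {P : ι → α → Prop} {t : ℝ} {F : α → Finset ι}
    (hF : ∀ x, G x → ∀ i ∈ F x, P i x) (hcard : ∀ x, G x → t ≤ (F x).card) :
    t * weight μ G ≤ ∑ i, weight μ (P i) := by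
  classical
  unfold weight
  rw [Finset.sum_comm, Finset.mul_sum]
  refine Finset.sum_le_sum fun x _ => ?_
  by_cases hx : G x
  · rw [if_pos hx, ← Finset.sum_filter, Finset.sum_const, nsmul_eq_mul]
    refine mul_le_mul_of_nonneg_right ((hcard x hx).trans ?_) (hμ x)
    exact_mod_cast Finset.card_le_card fun i hi => by simpa using hF x hx i hi
  · rw [if_neg hx, mul_zero]
    exact Finset.sum_nonneg fun i _ => by split_ifs <;> simp [hμ x]

theorem sum_ne_community {n k m : ℕ} {θ : Fin n → Fin k}
    (hbal : ∀ j : Fin k, (Finset.univ.filter fun i => θ i = j).card = m)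
    (q : Fin k → ℝ) (a : Fin k) :
    ∑ j with θ j ≠ a, q (θ j) = m * ∑ b with b ≠ a, q b := by
  rw [Finset.sum_filter, ← Finset.sum_fiberwise Finset.univ θ, Finset.sum_filter, Finset.mul_sum]
  refine Finset.sum_congr rfl fun b _ => ?_
  rw [Finset.sum_congr rfl (g := fun _ => if b ≠ a then q b else 0), Finset.sum_const, hbal,
    nsmul_eq_mul]
  intro j hj
  rw [(Finset.mem_filter.1 hj).2]

/-- A weight of total mass one which is stable under transpositions of nodes cannot concentrate
on labellings close to `θ`. -/
theorem weight_fewErrors_le {n k m : ℕ} (hn : n = k * m) (hk : 1 ≤ k) (hm : 6 ≤ m)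
    {θ : Fin n → Fin k}
    (hbal : ∀ j : Fin k, (Finset.univ.filter fun i => θ i = j).card = m)
    {ξ : ℝ} (hξ : ξ < 1 / 3)
    {μ : (Fin n → Fin k) → ℝ} (hμ : ∀ x, 0 ≤ μ x) (hμ1 : ∑ x, μ x = 1) {e η : ℝ} (he : 0 ≤ e)
    (hstable : ∀ (i j : Fin n) (P : (Fin n → Fin k) → Prop),
      e * weight μ P ≤ weight μ (fun x => P (x ∘ Equiv.swap i j)) + η) :
    (1 + ((k : ℝ) - 1) * e) * ((1 - ξ / 2) * weight μ (fun x => ∃ σ, FewErrors θ (ξ * m / 2) x σ))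
      ≤ 1 + ((k : ℝ) - 1) * η := by
  classical
  set c : ℝ := ξ * m / 2 with hc
  have hm' : (6 : ℝ) ≤ m := by exact_mod_cast hm
  have hn' : (n : ℝ) = k * m := by exact_mod_cast hn
  let p : Fin n → ℝ := fun i => weight μ fun x => ∃ σ, FewErrors θ c x σ ∧ σ (x i) = θ i
  let q : Fin n → Fin k → ℝ := fun i b =>
    weight μ fun x => ∃ σ, FewErrors θ (c + 2) x σ ∧ σ (x i) = b
  have hpq : ∀ i, p i ≤ q i (θ i) := fun i => weight_mono hμ
    fun x ⟨σ, h1, h2⟩ => ⟨σ, h1.mono (by linarith), h2⟩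
  have hswap : ∀ i j, e * p j ≤ q i (θ j) + η := by
    intro i j
    refine (hstable i j _).trans (add_le_add_left (weight_mono hμ ?_) η)
    rintro x ⟨σ, h1, h2⟩
    exact ⟨σ, h1.comp_swap, by simpa using h2⟩
  have hq : ∀ i, ∑ b, q i b ≤ 1 := by
    intro i
    rw [← hμ1]
    refine sum_weight_le hμ ?_
    rintro x b b' ⟨σ, h1, h2⟩ ⟨τ, h3, h4⟩
    rw [← h2, ← h4, FewErrors.unique hbal (by nlinarith) h1 h3]
  have hcorrect : n * (1 - ξ / 2) * weight μ (fun x => ∃ σ, FewErrors θ c x σ) ≤ ∑ i, p i := by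
    have hF : ∀ x, (∃ σ, FewErrors θ c x σ) → ∃ F : Finset (Fin n),
        (∀ i ∈ F, ∃ σ, FewErrors θ c x σ ∧ σ (x i) = θ i) ∧ n * (1 - ξ / 2) ≤ F.card := by
      rintro x ⟨σ, h⟩
      refine ⟨Finset.univ.filter fun i => σ (x i) = θ i,
        fun i hi => ⟨σ, h, (Finset.mem_filter.1 hi).2⟩, ?_⟩
      have hsplit := Finset.card_filter_add_card_filter_not (s := (Finset.univ : Finset (Fin n)))
        (fun i => σ (x i) = θ i)
      have hwrong : (Finset.univ.filter fun i => ¬ σ (x i) = θ i).card =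
          ∑ j, (Finset.univ.filter fun i => θ i = j ∧ σ (x i) ≠ j).card := by
        rw [Finset.card_eq_sum_card_fiberwise (f := θ) (t := Finset.univ) (by simp)]
        refine Finset.sum_congr rfl fun j _ => congrArg _ ?_
        ext i
        simp only [Finset.mem_filter, Finset.mem_univ, true_and]
        constructor
        · rintro ⟨h1, rfl⟩
          exact ⟨rfl, h1⟩
        · rintro ⟨rfl, h1⟩
          exact ⟨h1, rfl⟩
      have hbound : ((Finset.univ.filter fun i => ¬ σ (x i) = θ i).card : ℝ) ≤ k * c := by
        rw [hwrong, Nat.cast_sum]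
        exact (Finset.sum_le_sum fun j _ => h j).trans (by simp)
      rw [Finset.card_univ, Fintype.card_fin] at hsplit
      have hsplit' := congrArg (Nat.cast (R := ℝ)) hsplit
      push_cast at hsplit'
      rw [hc] at hbound
      rw [hn'] at hsplit' ⊢
      linarith
    choose! F hF hcard using hF
    exact le_sum_weight hμ hF hcard
  have hnode : ∀ i, m * p i + e * (∑ j, p j - ∑ j with θ j = θ i, p j) ≤
      m + ((k : ℝ) - 1) * m * η := by
    intro i
    have hcompl := Finset.sum_filter_add_sum_filter_not Finset.univ (fun j => θ j = θ i) p
    have hcomm : ∑ b with b ≠ θ i, q i b ≤ 1 - p i := by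
      have h1 := Finset.sum_filter_add_sum_filter_not Finset.univ (fun b => b = θ i) (q i)
      rw [Finset.filter_eq' Finset.univ (θ i), if_pos (Finset.mem_univ _),
        Finset.sum_singleton] at h1
      linarith [hq i, hpq i]
    have hcount : ∑ j with θ j ≠ θ i, η = ((k : ℝ) - 1) * m * η := by
      rw [sum_ne_community hbal (fun _ => η) (θ i), Finset.sum_const, nsmul_eq_mul,
        Finset.filter_ne', Finset.card_erase_of_mem (Finset.mem_univ _), Finset.card_univ,
        Fintype.card_fin, Nat.cast_sub hk, Nat.cast_one]
      ring
    have hsum : ∑ j with θ j ≠ θ i, e * p j ≤ ∑ j with θ j ≠ θ i, (q i (θ j) + η) :=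
      Finset.sum_le_sum fun j _ => hswap i j
    rw [Finset.sum_add_distrib, hcount, sum_ne_community hbal, ← Finset.mul_sum] at hsum
    have hmul := mul_le_mul_of_nonneg_left hcomm (Nat.cast_nonneg (α := ℝ) m)
    have hrw : ∑ j, p j - ∑ j with θ j = θ i, p j = ∑ j with θ j ≠ θ i, p j := by linarith
    rw [hrw]
    linarith
  have hdouble : ∑ i, ∑ j with θ j = θ i, p j = m * ∑ j, p j := by
    simp_rw [Finset.sum_filter]
    rw [Finset.sum_comm, Finset.mul_sum]
    refine Finset.sum_congr rfl fun j _ => ?_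
    rw [← Finset.sum_filter, Finset.sum_const, nsmul_eq_mul, ← hbal (θ j)]
    simp_rw [eq_comm]
  have htotal := Finset.sum_le_sum fun i (_ : i ∈ Finset.univ) => hnode i
  rw [Finset.sum_add_distrib, ← Finset.mul_sum, ← Finset.mul_sum, Finset.sum_sub_distrib,
    hdouble] at htotal
  simp only [Finset.sum_const, Finset.card_univ, Fintype.card_fin, nsmul_eq_mul] at htotal
  set s := ∑ i, p i
  have hm0 : (0 : ℝ) < m := by linarith
  have hk' : (1 : ℝ) ≤ k := by exact_mod_cast hk
  have hD : 0 ≤ 1 + ((k : ℝ) - 1) * e :=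
    add_nonneg zero_le_one (mul_nonneg (sub_nonneg.2 hk') he)
  have hs : (1 + ((k : ℝ) - 1) * e) * s ≤ n * (1 + ((k : ℝ) - 1) * η) := by
    refine le_of_mul_le_mul_left ?_ hm0
    rw [hn'] at htotal ⊢
    linarith
  refine le_of_mul_le_mul_left ?_ (show (0 : ℝ) < n by rw [hn']; positivity)
  linarith [mul_le_mul_of_nonneg_left hcorrect hD]

theorem permMat_conj {n : ℕ} (σ : Equiv.Perm (Fin n)) (A : Matrix (Fin n) (Fin n) ℝ) :
    permMat σ * A * (permMat σ)ᵀ = A.submatrix ⇑σ⁻¹ ⇑σ⁻¹ := by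
  ext i j
  simp [permMat, Matrix.mul_apply, ← Equiv.Perm.eq_inv_iff_eq]

theorem toOuterMeasure_ne_top {α : Type*} (p : PMF α) (S : Set α) :
    p.toOuterMeasure S ≠ ⊤ := by
  rw [PMF.toOuterMeasure_apply]
  refine ne_top_of_le_ne_top ENNReal.one_ne_top ?_
  rw [← p.tsum_coe]
  exact ENNReal.tsum_le_tsum fun x => Set.indicator_le_self _ _ x

theorem IsNodeDP.toReal_swap {n k : ℕ} {M : Matrix (Fin n) (Fin n) ℝ → PMF (Fin n → Fin k)}
    {ε δ : ℝ} (hδ : 0 ≤ δ) (hDP : IsNodeDP M ε δ) {A : Matrix (Fin n) (Fin n) ℝ}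
    (hA : Is01 A) (i j : Fin n) (S : Set (Fin n → Fin k)) :
    ((M A).toOuterMeasure S).toReal ≤ Real.exp ε * (Real.exp ε *
      ((M (A.submatrix (Equiv.swap i j) (Equiv.swap i j))).toOuterMeasure S).toReal + δ) + δ := by
  have step : ∀ A A', Is01 A → Is01 A' → NodeAdj A A' →
      ((M A).toOuterMeasure S).toReal ≤
        Real.exp ε * ((M A').toOuterMeasure S).toReal + δ := by
    intro A A' hA hA' h
    have hfin : ∀ B, (M B).toOuterMeasure S ≠ ⊤ := fun B => toOuterMeasure_ne_top _ _
    have hle := hDP A A' hA hA' h S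
    have hmul := ENNReal.mul_ne_top (ENNReal.ofReal_ne_top (r := Real.exp ε)) (hfin A')
    have := ENNReal.toReal_mono (ENNReal.add_ne_top.2 ⟨hmul, ENNReal.ofReal_ne_top⟩) hle
    rwa [ENNReal.toReal_add hmul ENNReal.ofReal_ne_top, ENNReal.toReal_mul,
      ENNReal.toReal_ofReal (Real.exp_pos ε).le, ENNReal.toReal_ofReal hδ] at this
  set B := A.submatrix (Equiv.swap i j) (Equiv.swap i j) with hBdef
  have hB : Is01 B := fun r c => hA _ _
  let C : Matrix (Fin n) (Fin n) ℝ := Matrix.of fun r c => if r = i ∨ c = i then B r c else A r c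
  have hC : Is01 C := by
    intro r c
    simp only [C, Matrix.of_apply]
    split_ifs
    · exact hB r c
    · exact hA r c
  have h1 := step A C hA hC ⟨i, fun r c hr hc => by simp [C, hr, hc]⟩
  have h2 := step C B hC hB ⟨j, fun r c hr hc => by
    by_cases h : r = i ∨ c = i
    · simp [C, h]
    · have h' := h
      push Not at h'
      simp [C, h, hBdef, Equiv.swap_apply_of_ne_of_ne h'.1 hr,
        Equiv.swap_apply_of_ne_of_ne h'.2 hc]⟩
  exact h1.trans (by gcongr)

theorem toReal_toOuterMeasure {α : Type*} [Fintype α] (p : PMF α) (P : α → Prop) :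
    (p.toOuterMeasure {x | P x}).toReal = weight (fun x => (p x).toReal) P := by
  classical
  rw [PMF.toOuterMeasure_apply_fintype, ENNReal.toReal_sum]
  · refine Finset.sum_congr rfl fun x _ => ?_
    by_cases h : P x <;> simp [h]
  · intro x _
    by_cases h : P x <;> simp [h, PMF.apply_ne_top]

theorem weight_swap {n k : ℕ} {M : Matrix (Fin n) (Fin n) ℝ → PMF (Fin n → Fin k)}
    (hsym : IsSymmetricMech M) {A : Matrix (Fin n) (Fin n) ℝ} (hA : Is01 A) (i j : Fin n)
    (P : (Fin n → Fin k) → Prop) :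
    weight (fun x => (M (A.submatrix (Equiv.swap i j) (Equiv.swap i j)) x).toReal) P =
      weight (fun x => (M A x).toReal) (fun x => P (x ∘ Equiv.swap i j)) := by
  classical
  unfold weight
  refine (Fintype.sum_equiv (Equiv.arrowCongr (Equiv.swap i j) (Equiv.refl _)) _ _ fun x => ?_).symm
  have h := hsym (Equiv.swap i j) A x hA
  rw [permMat_conj, Equiv.swap_inv] at h
  beta_reduce
  rw [h]
  rfl

/-- For `k ≥ 1` dividing `n` with `n/k ≥ 6`, a balanced `θ`, and a
symmetric `(ε,δ)`-node DP mechanism `M`, every `{0,1}` matrix `A` and every `ξ ∈ (0,1/3)`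
satisfy `P(𝓛̃(M(A), θ) ≤ ξ) ≤ 1/((1−ξ)(1+(k−1)e^{−2ε})) + 2(k−1)δ/(1−ξ)`. -/
theorem lower_bound_stable_mechanism {n k : ℕ} (hk : 1 ≤ k) (hkn : k ∣ n)
    (hsize : 6 ≤ n / k)
    (θ : Fin n → Fin k)
    (hbal : ∀ j : Fin k, (Finset.univ.filter fun i => θ i = j).card = n / k)
    (ε δ : ℝ) (hε : 0 ≤ ε) (hδ : 0 ≤ δ)
    (M : Matrix (Fin n) (Fin n) ℝ → PMF (Fin n → Fin k))
    (hDP : IsNodeDP M ε δ) (hsym : IsSymmetricMech M)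
    (A : Matrix (Fin n) (Fin n) ℝ) (hA : Is01 A)
    (ξ : ℝ) (hξ : ξ ∈ Set.Ioo (0 : ℝ) (1 / 3)) :
    (M A).toOuterMeasure {θhat | wcErr θhat θ ≤ ξ}
      ≤ ENNReal.ofReal (1 / ((1 - ξ) * (1 + ((k : ℝ) - 1) * Real.exp (-(2 * ε))))
          + 2 * ((k : ℝ) - 1) * δ / (1 - ξ)) := by
  obtain ⟨hξ0, hξ1⟩ := hξ
  set m := n / k with hmdef
  have hn : n = k * m := (Nat.mul_div_cancel' hkn).symm
  set μ : (Fin n → Fin k) → ℝ := fun x => (M A x).toReal with hμdef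
  have hμ : ∀ x, 0 ≤ μ x := fun x => ENNReal.toReal_nonneg
  have hμ1 : ∑ x, μ x = 1 := by
    have h := (M A).tsum_coe
    rw [tsum_fintype] at h
    rw [← ENNReal.toReal_sum fun x _ => PMF.apply_ne_top _ _, h, ENNReal.toReal_one]
  have hexp : Real.exp (-(2 * ε)) * (Real.exp ε * Real.exp ε) = 1 := by
    rw [← Real.exp_add, ← Real.exp_add, ← Real.exp_zero]
    congr 1
    ring
  have hexp' : Real.exp (-(2 * ε)) * (Real.exp ε + 1) ≤ 2 := by
    rw [mul_add, ← Real.exp_add, mul_one]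
    have h1 : Real.exp (-(2 * ε) + ε) ≤ 1 := Real.exp_le_one_iff.2 (by linarith)
    have h2 : Real.exp (-(2 * ε)) ≤ 1 := Real.exp_le_one_iff.2 (by linarith)
    linarith
  have hpos := Real.exp_pos (-(2 * ε))
  set e := Real.exp (-(2 * ε))
  have hstable : ∀ (i j : Fin n) (P : (Fin n → Fin k) → Prop),
      e * weight μ P ≤ weight μ (fun x => P (x ∘ Equiv.swap i j)) + 2 * δ := by
    intro i j P
    have h := hDP.toReal_swap hδ hA i j {x | P x}
    rw [toReal_toOuterMeasure, toReal_toOuterMeasure, weight_swap hsym hA] at h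
    calc e * weight μ P ≤ e * (Real.exp ε * (Real.exp ε *
          weight μ (fun x => P (x ∘ Equiv.swap i j)) + δ) + δ) := by gcongr
      _ = (e * (Real.exp ε * Real.exp ε)) * weight μ (fun x => P (x ∘ Equiv.swap i j))
          + e * (Real.exp ε + 1) * δ := by ring
      _ ≤ _ := by rw [hexp, one_mul]; gcongr
  have hmain := weight_fewErrors_le hn hk hsize hbal hξ1 hμ hμ1 hpos.le hstable
  have hle : ((M A).toOuterMeasure {θhat | wcErr θhat θ ≤ ξ}).toReal ≤
      weight μ (fun x => ∃ σ, FewErrors θ (ξ * m / 2) x σ) := by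
    rw [toReal_toOuterMeasure]
    exact weight_mono hμ fun x hx => exists_fewErrors_of_wcErr_le (by omega) hbal hx
  rw [← ENNReal.ofReal_toReal (toOuterMeasure_ne_top (M A) _)]
  refine ENNReal.ofReal_le_ofReal (hle.trans ?_)
  have hk' : (0 : ℝ) ≤ (k : ℝ) - 1 := by
    have : (1 : ℝ) ≤ k := by exact_mod_cast hk
    linarith
  have hw : 0 ≤ weight μ (fun x => ∃ σ, FewErrors θ (ξ * m / 2) x σ) := by
    unfold weight
    exact Finset.sum_nonneg fun x _ => by split_ifs <;> simp [hμ x]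
  set w := weight μ (fun x => ∃ σ, FewErrors θ (ξ * m / 2) x σ)
  have hD : 1 ≤ 1 + ((k : ℝ) - 1) * e := by nlinarith
  set D := 1 + ((k : ℝ) - 1) * e
  have hξ' : 0 < 1 - ξ := by linarith
  have hDδ : ((k : ℝ) - 1) * (2 * δ) ≤ D * (((k : ℝ) - 1) * (2 * δ)) :=
    le_mul_of_one_le_left (by positivity) hD
  have hDw : D * ((1 - ξ) * w) ≤ D * ((1 - ξ / 2) * w) := by gcongr; linarith
  have hD0 : 0 < D := by linarith
  have hrw : 1 / ((1 - ξ) * D) + 2 * ((k : ℝ) - 1) * δ / (1 - ξ) =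
      (1 + D * (((k : ℝ) - 1) * (2 * δ))) / ((1 - ξ) * D) := by
    field_simp
  rw [hrw, le_div_iff₀ (by positivity)]
  linarith
end

section
/- Let θ ∈ [k]^n have all communities of size m = n/k, with membership matrix Θ. Let θ̂₁, θ̂₂ ∈ [k]^n have membership matrices Θ̂₁, Θ̂₂. Suppose 𝓛(θ̂₁, θ) ≤ η and 𝓛̃(θ̂₂, θ) ≤ ξ, and let J₁ ∈ argmin_{J ∈ E_k} ‖Θ̂₁ J − Θ‖₀ and J₂ ∈ argmin_{J ∈ E_k} ‖Θ̂₂ J − Θ‖₀. If (ξ + 2ηk + ξk)/2 < 1, then J₂ J₁^{−1} is the unique minimizer of J ↦ ‖Θ̂₂ J − Θ̂₁‖₀ over E_k. -/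
/-- The overall misclassification error `𝓛(θ̂, θ) = min_{σ ∈ S_k} (2/n) #{i : σ(θ̂_i) ≠ θ_i}`. -/
noncomputable def ovErr {n k : ℕ} (θhat θ : Fin n → Fin k) : ℝ :=
  ⨅ σ : Equiv.Perm (Fin k),
    (2 / (n : ℝ)) * ((Finset.univ.filter fun i => σ (θhat i) ≠ θ i).card : ℝ)

open Finset in
/-- Agreements and disagreements under a relabeling add up to the number of nodes. -/
theorem sum_agreement_add_misCount {n k : ℕ} (f g : Fin n → Fin k) (σ : Equiv.Perm (Fin k)) :
    (∑ l, (univ.filter fun i => f i = l ∧ g i = σ l).card) + misCount f g σ = n := by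
  have hsum : (univ.filter fun i => σ (f i) = g i).card =
      ∑ l, (univ.filter fun i => f i = l ∧ g i = σ l).card := by
    rw [card_eq_sum_card_fiberwise (f := f) (t := univ) (fun _ _ => mem_coe.2 (mem_univ _))]
    refine sum_congr rfl fun l _ => congrArg card ?_
    ext i
    simp only [mem_filter, mem_univ, true_and]
    constructor
    · rintro ⟨h, rfl⟩
      exact ⟨rfl, h.symm⟩
    · rintro ⟨rfl, h⟩
      exact ⟨h.symm, rfl⟩
  have h := card_filter_add_card_filter_not (s := (univ : Finset (Fin n)))
    (fun i => σ (f i) = g i)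
  rw [hsum, card_univ, Fintype.card_fin] at h
  exact h

open Finset in
/-- If `σ l` is the strict plurality label of `g` on every cluster `f = l`, then `σ` is the unique
minimizer of the misclassification count. -/
theorem misCount_lt_of_plurality {n k : ℕ} {f g : Fin n → Fin k} {σ σ' : Equiv.Perm (Fin k)}
    (h : ∀ l j, j ≠ σ l → (univ.filter fun i => f i = l ∧ g i = j).card <
      (univ.filter fun i => f i = l ∧ g i = σ l).card) (hne : σ' ≠ σ) :
    misCount f g σ < misCount f g σ' := by
  have hlt : (∑ l, (univ.filter fun i => f i = l ∧ g i = σ' l).card) <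
      ∑ l, (univ.filter fun i => f i = l ∧ g i = σ l).card := by
    obtain ⟨l, hl⟩ : ∃ l, σ' l ≠ σ l := by
      by_contra! hall
      exact hne (Equiv.ext hall)
    refine sum_lt_sum (fun l _ => ?_) ⟨l, mem_univ _, h l _ hl⟩
    by_cases hl : σ' l = σ l
    · rw [hl]
    · exact (h l _ hl).le
  have h₁ := sum_agreement_add_misCount f g σ
  have h₂ := sum_agreement_add_misCount f g σ'
  omega

/-- An optimal alignment attains at most half the overall misclassification error. -/
theorem two_mul_misCount_le_of_ovErr_le {n k : ℕ} (hn : 0 < n) {f θ : Fin n → Fin k} {η : ℝ}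
    (h : ovErr f θ ≤ η) {σ : Equiv.Perm (Fin k)}
    (hσ : ∀ σ', misCount f θ σ ≤ misCount f θ σ') :
    2 * (misCount f θ σ : ℝ) ≤ n * η := by
  obtain ⟨τ, hτ⟩ := exists_eq_ciInf_of_finite (f := fun σ : Equiv.Perm (Fin k) =>
    (2 / (n : ℝ)) * ((Finset.univ.filter fun i => σ (f i) ≠ θ i).card : ℝ))
  have hle : (2 / (n : ℝ)) * (misCount f θ τ : ℝ) ≤ η := hτ.le.trans h
  have hn' : (0 : ℝ) < n := Nat.cast_pos.2 hn
  have hστ : (misCount f θ σ : ℝ) ≤ misCount f θ τ := Nat.cast_le.2 (hσ τ)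
  rw [div_mul_eq_mul_div, div_le_iff₀ hn'] at hle
  linarith

/-- Some relabeling attains the worst-case misclassification error in every community. -/
theorem exists_perm_of_wcErr_le {n k m : ℕ} (hm : 0 < m) {f θ : Fin n → Fin k} {ξ : ℝ}
    (hbal : ∀ j : Fin k, (Finset.univ.filter fun i => θ i = j).card = m)
    (h : wcErr f θ ≤ ξ) :
    ∃ τ : Equiv.Perm (Fin k), ∀ j,
      2 * ((Finset.univ.filter fun i => θ i = j ∧ τ (f i) ≠ j).card : ℝ) ≤ m * ξ := by
  obtain ⟨τ, hτ⟩ := exists_eq_ciInf_of_finite (f := fun σ : Equiv.Perm (Fin k) => ⨆ j : Fin k,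
    (2 / ((Finset.univ.filter fun i => θ i = j).card : ℝ)) *
      ((Finset.univ.filter fun i => θ i = j ∧ σ (f i) ≠ j).card : ℝ))
  refine ⟨τ, fun j => ?_⟩
  have hle := (le_ciSup (f := fun j : Fin k =>
    (2 / ((Finset.univ.filter fun i => θ i = j).card : ℝ)) *
      ((Finset.univ.filter fun i => θ i = j ∧ τ (f i) ≠ j).card : ℝ))
    (Set.finite_range _).bddAbove j).trans (hτ.le.trans h)
  have hm' : (0 : ℝ) < m := Nat.cast_pos.2 hm
  simp only [hbal] at hle
  rw [div_mul_eq_mul_div, div_le_iff₀ hm'] at hle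
  linarith

open Finset in
/-- A cluster of `f` and a cluster of `g` that are aligned to different communities share only
misclassified nodes. -/
theorem card_overlap_le {n k : ℕ} (θ f g : Fin n → Fin k) (σ τ : Equiv.Perm (Fin k))
    {l j : Fin k} (hne : σ j ≠ τ l) :
    (univ.filter fun i => f i = l ∧ g i = j).card ≤
      (univ.filter fun i => θ i = σ j ∧ τ (f i) ≠ σ j).card + misCount g θ σ := by
  refine (card_le_card fun i hi => ?_).trans (card_union_le _ _)
  simp only [mem_union, mem_filter, mem_univ, true_and] at hi ⊢
  obtain ⟨rfl, rfl⟩ := hi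
  by_cases h : σ (g i) = θ i
  · exact Or.inl ⟨h.symm, hne.symm⟩
  · exact Or.inr h

open Finset in
/-- Clusters of `f` and `g` aligned to the same community share all of that community except
for the misclassified nodes. -/
theorem card_community_le {n k : ℕ} (θ f g : Fin n → Fin k) (σ τ : Equiv.Perm (Fin k))
    {l j : Fin k} (heq : σ j = τ l) :
    (univ.filter fun i => θ i = τ l).card ≤
      (univ.filter fun i => f i = l ∧ g i = j).card +
        (univ.filter fun i => θ i = τ l ∧ τ (f i) ≠ τ l).card + misCount g θ σ := by
  refine (card_le_card fun i hi => ?_).trans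
    ((card_union_le _ _).trans (Nat.add_le_add_right (card_union_le _ _) _))
  simp only [mem_union, mem_filter, mem_univ, true_and] at hi ⊢
  by_cases h : σ (g i) = θ i
  · by_cases h' : f i = l
    · exact Or.inl (Or.inl ⟨h', σ.injective (by rw [h, hi, heq])⟩)
    · exact Or.inl (Or.inr ⟨hi, fun hc => h' (τ.injective hc)⟩)
  · exact Or.inr h

open Finset in
/-- If `f` is accurate on every community and `g` is accurate overall, then the induced alignment
of `f` to `g` is the unique minimizer of the misclassification count. -/
theorem misCount_inv_mul_lt {n k m : ℕ} {θ f g : Fin n → Fin k} {σ τ : Equiv.Perm (Fin k)}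
    {ξ : ℝ} (hbal : ∀ j : Fin k, (univ.filter fun i => θ i = j).card = m)
    (hτ : ∀ j, 2 * ((univ.filter fun i => θ i = j ∧ τ (f i) ≠ j).card : ℝ) ≤ m * ξ)
    (hlt : m * ξ + 2 * (misCount g θ σ : ℝ) < m) {σ' : Equiv.Perm (Fin k)}
    (hne : σ' ≠ σ⁻¹ * τ) :
    misCount f g (σ⁻¹ * τ) < misCount f g σ' := by
  refine misCount_lt_of_plurality (fun l j hj => ?_) hne
  have heq : σ ((σ⁻¹ * τ) l) = τ l := by simp
  have hj' : σ j ≠ τ l := fun hc => hj (σ.injective (hc.trans heq.symm))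
  have h₁ := card_overlap_le θ f g σ τ hj'
  have h₂ := card_community_le θ f g σ τ heq
  rw [hbal] at h₂
  have h₃ := hτ (σ j)
  have h₄ := hτ (τ l)
  rify at h₁ h₂ ⊢
  linarith

/-- If `θ` is balanced, `𝓛(θ̂₁, θ) ≤ η`, `𝓛̃(θ̂₂, θ) ≤ ξ`, `σ₁` and `σ₂` are
optimal alignments of `θ̂₁` and `θ̂₂` to `θ`, and `(ξ + 2ηk + ξk)/2 < 1`, then `σ₁⁻¹ σ₂`
(corresponding to the permutation matrix `J₂ J₁⁻¹`) is the unique minimizer of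
`σ ↦ ‖Θ̂₂ J_σ − Θ̂₁‖₀`. -/
theorem unique_alignment {n k : ℕ} (hn : 0 < n) (hk : 0 < k) (hkn : k ∣ n)
    (θ θhat₁ θhat₂ : Fin n → Fin k)
    (hbal : ∀ j : Fin k, (Finset.univ.filter fun i => θ i = j).card = n / k)
    (η ξ : ℝ)
    (h1 : ovErr θhat₁ θ ≤ η) (h2 : wcErr θhat₂ θ ≤ ξ)
    (σ₁ σ₂ : Equiv.Perm (Fin k))
    (hσ₁ : ∀ σ', misCount θhat₁ θ σ₁ ≤ misCount θhat₁ θ σ')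
    (hσ₂ : ∀ σ', misCount θhat₂ θ σ₂ ≤ misCount θhat₂ θ σ')
    (hcond : (ξ + 2 * η * k + ξ * k) / 2 < 1) :
    (∀ σ', misCount θhat₂ θhat₁ (σ₁⁻¹ * σ₂) ≤ misCount θhat₂ θhat₁ σ') ∧
    (∀ σ', (∀ σ'', misCount θhat₂ θhat₁ σ' ≤ misCount θhat₂ θhat₁ σ'') → σ' = σ₁⁻¹ * σ₂) := by
  have hm : 0 < n / k := Nat.div_pos (Nat.le_of_dvd hn hkn) hk
  have hm' : (0 : ℝ) < (n / k : ℕ) := Nat.cast_pos.2 hm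
  have hnm : (n : ℝ) = (n / k : ℕ) * k := by exact_mod_cast (Nat.div_mul_cancel hkn).symm
  have hk' : (1 : ℝ) ≤ k := by exact_mod_cast hk
  obtain ⟨τ, hτ⟩ := exists_perm_of_wcErr_le hm hbal h2
  have hD := two_mul_misCount_le_of_ovErr_le hn h1 hσ₁
  have hξ : 0 ≤ ξ :=
    nonneg_of_mul_nonneg_right ((by positivity : (0 : ℝ) ≤ _).trans (hτ ⟨0, hk⟩)) hm'
  have hη : 0 ≤ n * η := (by positivity : (0 : ℝ) ≤ _).trans hD
  have hsmall : ξ + k * η < 1 := by nlinarith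
  have hsum : (n / k : ℕ) * ξ + n * η < (n / k : ℕ) := by
    rw [hnm]
    nlinarith [mul_lt_mul_of_pos_left hsmall hm']
  have hself : misCount θ θ 1 = 0 := by simp [misCount]
  have hτσ : σ₂ = τ := by
    by_contra hne
    have hlt := misCount_inv_mul_lt (g := θ) (σ := 1) (σ' := σ₂) hbal hτ
      (by rw [hself, Nat.cast_zero]; linarith) (by simpa using hne)
    rw [inv_one, one_mul] at hlt
    exact (hσ₂ τ).not_gt hlt
  subst hτσ
  have hmain : ∀ σ', σ' ≠ σ₁⁻¹ * σ₂ →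
      misCount θhat₂ θhat₁ (σ₁⁻¹ * σ₂) < misCount θhat₂ θhat₁ σ' :=
    fun σ' hne => misCount_inv_mul_lt hbal hτ (by linarith) hne
  refine ⟨fun σ' => ?_, fun σ' hmin => ?_⟩
  · by_cases h : σ' = σ₁⁻¹ * σ₂
    · rw [h]
    · exact (hmain σ' h).le
  · by_contra hne
    exact (hmin _).not_gt (hmain σ' hne)
end

section
/- Let k divide n and let Θ ∈ {0,1}^{n×k} be a membership matrix (exactly one 1 per row) whose k communities C₁,…,C_k each have size n/k. Let Z ∈ ℝ^{k×k} be orthogonal, Δ ∈ ℝ^{k×k} diagonal, U = √(k/n)·ΘZ (so UᵀU = I_k), and P = U Δ Uᵀ. Let S ⊆ {1,…,n} with |S| = m, let E ∈ {0,1}^{m×n} be the row-selection matrix picking out the rows indexed by S, and set m_i = |S ∩ C_i| for i = 1,…,k. Then: (i) (EΘ)ᵀ(EΘ) = diag(m₁,…,m_k); (ii) ‖EP‖₂ ≤ √((k/n)·max_i m_i) · max_i |Δ_{ii}|; and (iii) for every vector v in the column span of U, ‖E P v‖₂² ≥ (k/n)·(min_i m_i)·(min_i Δ_{ii}²)·‖v‖₂².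 -/
open Matrix

/-- The ℓ²→ℓ² operator norm (largest singular value) of a rectangular real matrix. -/
noncomputable def opNorm {a b : ℕ} (M : Matrix (Fin a) (Fin b) ℝ) : ℝ :=
  ‖LinearMap.toContinuousLinearMap (Matrix.toEuclideanLin M)‖

/-- The Gram matrix of the indicator matrix of a map is the diagonal matrix of fibre sizes. -/
theorem indicator_transpose_mul_self {ι κ : Type*} [Fintype ι] [DecidableEq κ] (f : ι → κ) :
    (Matrix.of fun i j => if f i = j then (1 : ℝ) else 0)ᵀ *
        (Matrix.of fun i j => if f i = j then (1 : ℝ) else 0) =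
      Matrix.diagonal fun j => ((Finset.univ.filter fun i => f i = j).card : ℝ) := by
  ext a b
  rw [Matrix.mul_apply, Matrix.diagonal_apply]
  simp only [Matrix.transpose_apply, Matrix.of_apply]
  split_ifs with h
  · subst h
    simp [← ite_and]
  · refine Finset.sum_eq_zero fun i _ => ?_
    by_cases h1 : f i = a
    · simp [h1, h]
    · simp [h1]

theorem mulVec_dotProduct_mulVec {ι κ : Type*} [Fintype ι] [Fintype κ]
    (M : Matrix ι κ ℝ) (x y : κ → ℝ) :
    (M *ᵥ x) ⬝ᵥ (M *ᵥ y) = x ⬝ᵥ ((Mᵀ * M) *ᵥ y) := by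
  rw [← Matrix.mulVec_mulVec, Matrix.dotProduct_mulVec x, Matrix.vecMul_transpose]

theorem sum_sq_mulVec_of_gram_eq_diagonal {ι κ : Type*} [Fintype ι] [Fintype κ] [DecidableEq κ]
    {M : Matrix ι κ ℝ} {d : κ → ℝ} (h : Mᵀ * M = Matrix.diagonal d) (x : κ → ℝ) :
    ∑ i, (M *ᵥ x) i ^ 2 = ∑ j, d j * x j ^ 2 := by
  have := mulVec_dotProduct_mulVec M x x
  rw [h] at this
  simp only [dotProduct, Matrix.mulVec_diagonal] at this
  simp only [sq]
  rw [this]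
  exact Finset.sum_congr rfl fun j _ => by ring

theorem sum_sq_mulVec_of_gram_eq_one {ι κ : Type*} [Fintype ι] [Fintype κ] [DecidableEq κ]
    {M : Matrix ι κ ℝ} (h : Mᵀ * M = 1) (x : κ → ℝ) :
    ∑ i, (M *ᵥ x) i ^ 2 = ∑ j, x j ^ 2 := by
  rw [← Matrix.diagonal_one] at h
  simpa using sum_sq_mulVec_of_gram_eq_diagonal h x

/-- Bessel's inequality for a matrix with orthonormal columns. -/
theorem sum_sq_transpose_mulVec_le {ι κ : Type*} [Fintype ι] [Fintype κ] [DecidableEq κ]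
    {M : Matrix ι κ ℝ} (h : Mᵀ * M = 1) (v : ι → ℝ) :
    ∑ j, (Mᵀ *ᵥ v) j ^ 2 ≤ ∑ i, v i ^ 2 := by
  set w := Mᵀ *ᵥ v with hw
  have h1 : ∑ i, v i * (M *ᵥ w) i = ∑ j, w j ^ 2 := by
    change v ⬝ᵥ (M *ᵥ w) = _
    rw [Matrix.dotProduct_mulVec, ← Matrix.mulVec_transpose, ← hw]
    simp only [dotProduct, sq]
  have h2 : 0 ≤ ∑ i, (v i - (M *ᵥ w) i) ^ 2 := Finset.sum_nonneg fun i _ => sq_nonneg _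
  have h3 : ∑ i, (v i - (M *ᵥ w) i) ^ 2 =
      ∑ i, v i ^ 2 - 2 * ∑ i, v i * (M *ᵥ w) i + ∑ i, (M *ᵥ w) i ^ 2 := by
    rw [Finset.mul_sum, ← Finset.sum_sub_distrib, ← Finset.sum_add_distrib]
    exact Finset.sum_congr rfl fun i _ => by ring
  rw [h3, h1, sum_sq_mulVec_of_gram_eq_one h] at h2
  linarith

theorem opNorm_le_of_sum_sq_le {a b : ℕ} (M : Matrix (Fin a) (Fin b) ℝ) {C : ℝ} (hC : 0 ≤ C)
    (h : ∀ v : Fin b → ℝ, ∑ i, (M *ᵥ v) i ^ 2 ≤ C ^ 2 * ∑ i, v i ^ 2) : opNorm M ≤ C := by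
  refine ContinuousLinearMap.opNorm_le_bound _ hC fun x => ?_
  refine (sq_le_sq₀ (norm_nonneg _) (by positivity)).1 ?_
  rw [mul_pow, EuclideanSpace.real_norm_sq_eq, EuclideanSpace.real_norm_sq_eq]
  exact h x.ofLp

/-- Deterministic core of the subsampled singular-value lemma.  With `Θ` the
membership matrix of a balanced assignment `θ` (communities of size `n/k`), `Z` orthogonal,
`Δ = diag(dvec)`, `U = √(k/n)·ΘZ`, `P = UΔUᵀ`, and `E` the row-selection matrix of an
`m`-element subset `S = range r` of rows (`r : Fin m ↪ Fin n` an injection), with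
`mcard i = |S ∩ Cᵢ|`:
(i) `(EΘ)ᵀ(EΘ) = diag(m₁,…,m_k)`;
(ii) `‖EP‖₂ ≤ √((k/n)·maxᵢ mᵢ)·maxᵢ |Δᵢᵢ|`;
(iii) for every `v` in the column span of `U`,
`‖EPv‖₂² ≥ (k/n)·(minᵢ mᵢ)·(minᵢ Δᵢᵢ²)·‖v‖₂²`. -/
theorem subsample_membership_bounds {n k m : ℕ} (hk : 0 < k) (hn : 0 < n) (hkn : k ∣ n)
    (θ : Fin n → Fin k)
    (hbal : ∀ j : Fin k, (Finset.univ.filter fun i => θ i = j).card = n / k)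
    (Z : Matrix (Fin k) (Fin k) ℝ) (hZ : Zᵀ * Z = 1)
    (dvec : Fin k → ℝ)
    (r : Fin m ↪ Fin n)
    (Θ : Matrix (Fin n) (Fin k) ℝ)
    (hΘ : Θ = Matrix.of fun i j => if θ i = j then (1 : ℝ) else 0)
    (E : Matrix (Fin m) (Fin n) ℝ)
    (hE : E = Matrix.of fun (a : Fin m) (j : Fin n) => if r a = j then (1 : ℝ) else 0)
    (U : Matrix (Fin n) (Fin k) ℝ)
    (hU : U = Real.sqrt ((k : ℝ) / n) • (Θ * Z))
    (P : Matrix (Fin n) (Fin n) ℝ)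
    (hP : P = U * Matrix.diagonal dvec * Uᵀ)
    (mcard : Fin k → ℕ)
    (hmcard : mcard = fun i => (Finset.univ.filter fun a : Fin m => θ (r a) = i).card) :
    ((E * Θ)ᵀ * (E * Θ) = Matrix.diagonal fun i => (mcard i : ℝ)) ∧
    (opNorm (E * P)
      ≤ Real.sqrt (((k : ℝ) / n) * (⨆ i : Fin k, (mcard i : ℝ))) *
          (⨆ i : Fin k, |dvec i|)) ∧
    (∀ v ∈ Set.range U.mulVec,
      ((k : ℝ) / n) * (⨅ i : Fin k, (mcard i : ℝ)) * (⨅ i : Fin k, (dvec i) ^ 2) *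
          (∑ i, (v i) ^ 2)
        ≤ ∑ a, (((E * P).mulVec v) a) ^ 2) := by
  have hkn' : (k : ℝ) / n * ((n / k : ℕ) : ℝ) = 1 := by
    have hk' : (k : ℝ) ≠ 0 := by positivity
    have hn' : (n : ℝ) ≠ 0 := by positivity
    rw [Nat.cast_div hkn hk']
    field_simp
  have hkn0 : (0 : ℝ) ≤ (k : ℝ) / n := by positivity
  have hsqrt : Real.sqrt ((k : ℝ) / n) ^ 2 = (k : ℝ) / n := Real.sq_sqrt hkn0
  have hEΘ : E * Θ = Matrix.of fun a j => if θ (r a) = j then (1 : ℝ) else 0 := by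
    ext a j
    simp only [hE, hΘ, Matrix.mul_apply, Matrix.of_apply, ite_mul, one_mul, zero_mul,
      Finset.sum_ite_eq, Finset.mem_univ, if_true]
  have hgram : (E * Θ)ᵀ * (E * Θ) = Matrix.diagonal fun i => (mcard i : ℝ) := by
    rw [hEΘ, hmcard]
    exact indicator_transpose_mul_self fun a => θ (r a)
  have hUU : Uᵀ * U = 1 := by
    have hΘΘ : Θᵀ * Θ = ((n / k : ℕ) : ℝ) • (1 : Matrix (Fin k) (Fin k) ℝ) := by
      rw [hΘ, indicator_transpose_mul_self, Matrix.smul_one_eq_diagonal]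
      simp only [hbal]
    have : (Θ * Z)ᵀ * (Θ * Z) = ((n / k : ℕ) : ℝ) • (1 : Matrix (Fin k) (Fin k) ℝ) := by
      rw [Matrix.transpose_mul, Matrix.mul_assoc, ← Matrix.mul_assoc Θᵀ, hΘΘ]
      simp [hZ]
    rw [hU, Matrix.transpose_smul, Matrix.smul_mul, Matrix.mul_smul, this, smul_smul, smul_smul,
      Real.mul_self_sqrt hkn0, hkn', one_smul]
  have hsum : ∀ v : Fin n → ℝ, ∑ a, ((E * P) *ᵥ v) a ^ 2 =
      (k : ℝ) / n * ∑ j, (mcard j : ℝ) *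
        (Z *ᵥ (Matrix.diagonal dvec *ᵥ (Uᵀ *ᵥ v))) j ^ 2 := by
    intro v
    have hEP : (E * P) *ᵥ v = Real.sqrt ((k : ℝ) / n) •
        ((E * Θ) *ᵥ (Z *ᵥ (Matrix.diagonal dvec *ᵥ (Uᵀ *ᵥ v)))) := by
      rw [hP]
      nth_rewrite 1 [hU]
      simp only [Matrix.mulVec_mulVec, Matrix.smul_mul, Matrix.mul_smul, Matrix.smul_mulVec,
        Matrix.mul_assoc]
    rw [hEP, ← sum_sq_mulVec_of_gram_eq_diagonal hgram, Finset.mul_sum]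
    simp only [Pi.smul_apply, smul_eq_mul, mul_pow, hsqrt]
  have hdiag : ∀ w : Fin k → ℝ, ∑ j, (Z *ᵥ (Matrix.diagonal dvec *ᵥ w)) j ^ 2 =
      ∑ j, dvec j ^ 2 * w j ^ 2 := by
    intro w
    simp only [sum_sq_mulVec_of_gram_eq_one hZ, Matrix.mulVec_diagonal, mul_pow]
  refine ⟨hgram, ?_, ?_⟩
  · set Mx := ⨆ i : Fin k, (mcard i : ℝ) with hMx
    set D := ⨆ i : Fin k, |dvec i| with hD
    have hM0 : 0 ≤ Mx := Real.iSup_nonneg fun i => Nat.cast_nonneg _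
    have hD0 : 0 ≤ D := Real.iSup_nonneg fun i => abs_nonneg _
    have hM : ∀ i, (mcard i : ℝ) ≤ Mx := le_ciSup (Set.finite_range _).bddAbove
    have hd : ∀ i, dvec i ^ 2 ≤ D ^ 2 := fun i =>
      sq_le_sq' (neg_le_of_abs_le (le_ciSup (f := fun i => |dvec i|)
          (Set.finite_range _).bddAbove i))
        (le_of_abs_le (le_ciSup (f := fun i => |dvec i|) (Set.finite_range _).bddAbove i))
    refine opNorm_le_of_sum_sq_le _ (by positivity) fun v => ?_
    rw [hsum, mul_pow, Real.sq_sqrt (by positivity), mul_assoc, mul_assoc]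
    refine mul_le_mul_of_nonneg_left ?_ hkn0
    calc _ ≤ ∑ j, Mx * (Z *ᵥ (Matrix.diagonal dvec *ᵥ (Uᵀ *ᵥ v))) j ^ 2 :=
          Finset.sum_le_sum fun j _ => mul_le_mul_of_nonneg_right (hM j) (sq_nonneg _)
      _ = Mx * ∑ j, dvec j ^ 2 * (Uᵀ *ᵥ v) j ^ 2 := by rw [← Finset.mul_sum, hdiag]
      _ ≤ Mx * ∑ j, D ^ 2 * (Uᵀ *ᵥ v) j ^ 2 := by
          exact mul_le_mul_of_nonneg_left (Finset.sum_le_sum fun j _ =>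
            mul_le_mul_of_nonneg_right (hd j) (sq_nonneg _)) hM0
      _ = Mx * (D ^ 2 * ∑ j, (Uᵀ *ᵥ v) j ^ 2) := by rw [← Finset.mul_sum]
      _ ≤ _ := by
          gcongr
          exact sum_sq_transpose_mulVec_le hUU v
  · rintro _ ⟨c, rfl⟩
    set mn := ⨅ i : Fin k, (mcard i : ℝ) with hmn
    set q := ⨅ i : Fin k, dvec i ^ 2 with hq
    have hmn0 : 0 ≤ mn := Real.iInf_nonneg fun i => Nat.cast_nonneg _
    have hm : ∀ i, mn ≤ (mcard i : ℝ) := ciInf_le (Set.finite_range _).bddBelow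
    have hd : ∀ i, q ≤ dvec i ^ 2 := ciInf_le (Set.finite_range _).bddBelow
    rw [hsum, Matrix.mulVec_mulVec (M := Uᵀ), hUU, Matrix.one_mulVec,
      sum_sq_mulVec_of_gram_eq_one hUU, mul_assoc, mul_assoc]
    refine mul_le_mul_of_nonneg_left ?_ hkn0
    calc _ = mn * ∑ j, q * c j ^ 2 := by rw [← Finset.mul_sum]
      _ ≤ mn * ∑ j, dvec j ^ 2 * c j ^ 2 := by
          exact mul_le_mul_of_nonneg_left (Finset.sum_le_sum fun j _ =>
            mul_le_mul_of_nonneg_right (hd j) (sq_nonneg _)) hmn0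
      _ = ∑ j, mn * (Z *ᵥ (Matrix.diagonal dvec *ᵥ c)) j ^ 2 := by
          rw [← Finset.mul_sum, hdiag]
      _ ≤ _ := Finset.sum_le_sum fun j _ => mul_le_mul_of_nonneg_right (hm j) (sq_nonneg _)
end
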